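/- Let p be a prime and F : 𝔽_{p^n} → 𝔽_{p^m} a function, and let 0 ≤ s ≤ n. Then F is vectorial s-plateaued if and only if for every x ∈ 𝔽_{p^n} and y ∈ 𝔽_{p^m}, ∑_{a ∈ 𝔽_{p^n}} #{s' ∈ 𝔽_{p^n} : y = F(s' + x − a) − F(s') + F(a)} equals α = p^{2n−m} − p^{n+s−m} when y ≠ F(x) and equals β = p^{n+s} + p^{2n−m} − p^{n+s−m} when y = F(x). -/

import Mathlib

open scoped BigOperators Classical

noncomputable instance galFintype (p n : ℕ) [Fact p.Prime] : Fintype (GaloisField p n) :=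
  Fintype.ofFinite _

/-- `eChar p k = ζ_p ^ k` where `ζ_p = exp(2πi/p)` and `k : ZMod p`. -/
noncomputable def eChar (p : ℕ) (k : ZMod p) : ℂ :=
  Complex.exp (2 * Real.pi * Complex.I / p) ^ k.val

/-- Absolute trace `Tr_n : 𝔽_{p^n} → 𝔽_p`. -/
noncomputable def trGF (p n : ℕ) [Fact p.Prime] (x : GaloisField p n) : ZMod p :=
  Algebra.trace (ZMod p) (GaloisField p n) x

/-- Walsh transform `f̂(μ) = ∑_x ζ_p^{f(x) - Tr_n(μ x)}`. -/
noncomputable def walsh (p n : ℕ) [Fact p.Prime] (f : GaloisField p n → ZMod p)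
    (μ : GaloisField p n) : ℂ :=
  ∑ x : GaloisField p n, eChar p (f x - trGF p n (μ * x))

/-- `f` is `s`-plateaued: `|f̂(μ)| ∈ {0, p^{(n+s)/2}}` for all `μ`. -/
def IsPlateaued (p n : ℕ) [Fact p.Prime] (f : GaloisField p n → ZMod p) (s : ℕ) : Prop :=
  ∀ μ : GaloisField p n, ‖walsh p n f μ‖ = 0 ∨
    ‖walsh p n f μ‖ = (p : ℝ) ^ (((n : ℝ) + (s : ℝ)) / 2)

/-- `δ_S(g) = #{(s,t) ∈ S × S : g = s - t}`. -/
def pgdsDelta {G : Type*} [AddCommGroup G] [DecidableEq G] (S : Finset G) (g : G) : ℕ :=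
  ((S ×ˢ S).filter fun st => g = st.1 - st.2).card

/-- `S` is a partial geometric difference set with parameters `(v, k; α, β)`. -/
def IsPGDS {G : Type*} [AddCommGroup G] [Fintype G] [DecidableEq G]
    (S : Finset G) (v k α β : ℕ) : Prop :=
  Fintype.card G = v ∧ S.card = k ∧
    ∀ x : G, (∑ y ∈ S, pgdsDelta S (x - y)) = if x ∈ S then β else α

open ComplexConjugate

section FourierTransform

variable {E : Type*} [Field E] [Fintype E] {ψ : AddChar E ℂ}

/-- The Fourier transform on a finite field is injective. -/
lemma eq_zero_of_forall_sum_mul_addChar_eq_zero (hψ : ψ.IsPrimitive) {f : E → ℂ}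
    (h : ∀ b, ∑ x, f x * ψ (b * x) = 0) (z : E) : f z = 0 := by
  have inversion : ∑ b, ψ (-(b * z)) * ∑ x, f x * ψ (b * x) = f z * Fintype.card E := by
    calc ∑ b, ψ (-(b * z)) * ∑ x, f x * ψ (b * x)
        = ∑ x, f x * ∑ b, ψ (b * (x - z)) := by
          simp_rw [Finset.mul_sum]
          rw [Finset.sum_comm]
          refine Finset.sum_congr rfl fun x _ => Finset.sum_congr rfl fun b _ => ?_
          rw [mul_sub, sub_eq_add_neg, AddChar.map_add_eq_mul]
          ring
      _ = f z * Fintype.card E := by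
          simp_rw [AddChar.sum_mulShift _ hψ, sub_eq_zero]
          simp
  simp only [h, mul_zero, Finset.sum_const_zero] at inversion
  simpa using inversion.symm

lemma eq_of_forall_sum_mul_addChar_eq (hψ : ψ.IsPrimitive) {f g : E → ℂ}
    (h : ∀ b, ∑ x, f x * ψ (b * x) = ∑ x, g x * ψ (b * x)) (z : E) : f z = g z := by
  refine sub_eq_zero.mp (eq_zero_of_forall_sum_mul_addChar_eq_zero hψ (f := fun x => f x - g x)
    (fun b => ?_) z)
  simp only [sub_mul, Finset.sum_sub_distrib, h, sub_self]

/-- The convolution of `g`, its conjugate reflection, and `g`. -/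
noncomputable def tripleConv (g : E → ℂ) (x : E) : ℂ :=
  ∑ a, ∑ t, g (t + x - a) * conj (g t) * g a

lemma sum_tripleConv_mul_addChar (ψ : AddChar E ℂ) (g : E → ℂ) (μ : E) :
    ∑ x, tripleConv g x * ψ (μ * x) =
      (∑ x, g x * ψ (μ * x)) * conj (∑ x, g x * ψ (μ * x)) * ∑ x, g x * ψ (μ * x) := by
  have inner (a t : E) : ∑ x, g (t + x - a) * conj (g t) * g a * ψ (μ * x) =
      ∑ u, (g u * ψ (μ * u)) * conj (g t * ψ (μ * t)) * (g a * ψ (μ * a)) := by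
    refine Fintype.sum_equiv (Equiv.addRight (t - a)) _ _ fun x => ?_
    have hu : (Equiv.addRight (t - a)) x = t + x - a := by
      simp only [Equiv.coe_addRight]; ring
    have hx : μ * x = μ * (t + x - a) + -(μ * t) + μ * a := by ring
    rw [hu, hx, AddChar.map_add_eq_mul, AddChar.map_add_eq_mul, AddChar.map_neg_eq_conj,
      map_mul (starRingEnd ℂ)]
    ring
  calc ∑ x, tripleConv g x * ψ (μ * x)
      = ∑ a, ∑ t, ∑ x, g (t + x - a) * conj (g t) * g a * ψ (μ * x) := by
        simp only [tripleConv, Finset.sum_mul]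
        rw [Finset.sum_comm]
        exact Finset.sum_congr rfl fun a _ => Finset.sum_comm
    _ = _ := by
        simp_rw [inner, ← Finset.sum_mul, ← Finset.mul_sum, ← map_sum]

end FourierTransform

/-- The canonical additive character of `GaloisField p n`. -/
noncomputable def galChar (p n : ℕ) [Fact p.Prime] : AddChar (GaloisField p n) ℂ :=
  (ZMod.stdAddChar (N := p)).compAddMonoidHom
    (Algebra.trace (ZMod p) (GaloisField p n)).toAddMonoidHom

lemma eChar_eq_stdAddChar (p : ℕ) [Fact p.Prime] (k : ZMod p) :
    eChar p k = ZMod.stdAddChar k := by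
  rw [eChar, ZMod.stdAddChar_apply, ZMod.toCircle_apply, ← Complex.exp_nat_mul]
  congr 1
  ring

lemma galChar_apply (p n : ℕ) [Fact p.Prime] (x : GaloisField p n) :
    galChar p n x = ZMod.stdAddChar (trGF p n x) := rfl

lemma galChar_isPrimitive (p n : ℕ) [Fact p.Prime] : (galChar p n).IsPrimitive := by
  refine AddChar.IsPrimitive.of_ne_one fun h => ?_
  obtain ⟨x, hx⟩ := Algebra.trace_surjective (ZMod p) (GaloisField p n) 1
  have h1 : ZMod.stdAddChar (1 : ZMod p) = 1 := by
    rw [← hx]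
    exact DFunLike.congr_fun h x
  rw [← (ZMod.stdAddChar (N := p)).map_zero_eq_one, ZMod.injective_stdAddChar.eq_iff] at h1
  exact one_ne_zero h1

lemma card_galoisField (p : ℕ) {n : ℕ} [Fact p.Prime] (hn : 0 < n) :
    Fintype.card (GaloisField p n) = p ^ n := by
  rw [← Nat.card_eq_fintype_card, GaloisField.card p n hn.ne']

lemma walsh_trGF (p n m : ℕ) [Fact p.Prime] (F : GaloisField p n → GaloisField p m)
    (b : GaloisField p m) (μ : GaloisField p n) :
    walsh p n (fun x => trGF p m (b * F x)) μ =
      ∑ x, galChar p m (b * F x) * galChar p n (-μ * x) := by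
  refine Finset.sum_congr rfl fun x _ => ?_
  rw [eChar_eq_stdAddChar, sub_eq_add_neg, AddChar.map_add_eq_mul, galChar_apply, galChar_apply,
    neg_mul]
  congr 2
  exact (map_neg (Algebra.trace (ZMod p) (GaloisField p n)) (μ * x)).symm

lemma norm_eq_zero_or_eq_iff {p : ℕ} (hp : 0 < p) (n s : ℕ) (w : ℂ) :
    (‖w‖ = 0 ∨ ‖w‖ = (p : ℝ) ^ (((n : ℝ) + (s : ℝ)) / 2)) ↔
      w * conj w * w = (p : ℂ) ^ (n + s) * w := by
  have hsq : ((p : ℝ) ^ (((n : ℝ) + (s : ℝ)) / 2)) ^ 2 = (p : ℝ) ^ (n + s) := by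
    rw [← Real.rpow_natCast, ← Real.rpow_mul (Nat.cast_nonneg p), ← Real.rpow_natCast]
    congr 1
    push_cast
    ring
  have hpos : 0 ≤ (p : ℝ) ^ (((n : ℝ) + (s : ℝ)) / 2) := by positivity
  rw [← sq_eq_sq₀ (norm_nonneg w) hpos, hsq, norm_eq_zero, Complex.mul_conj', mul_eq_mul_right_iff,
    or_comm]
  norm_cast

/-- A component function is plateaued iff it is an eigenfunction of its own triple convolution. -/
lemma isPlateaued_trGF_iff (p n m s : ℕ) [Fact p.Prime] (F : GaloisField p n → GaloisField p m)
    (b : GaloisField p m) :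
    IsPlateaued p n (fun x => trGF p m (b * F x)) s ↔
      ∀ x, tripleConv (fun x => galChar p m (b * F x)) x =
        (p : ℂ) ^ (n + s) * galChar p m (b * F x) := by
  simp only [IsPlateaued, norm_eq_zero_or_eq_iff (Fact.out : p.Prime).pos, walsh_trGF,
    ← sum_tripleConv_mul_addChar]
  refine ⟨fun h x => ?_, fun h μ => ?_⟩
  · refine eq_of_forall_sum_mul_addChar_eq (galChar_isPrimitive p n)
      (g := fun x => (p : ℂ) ^ (n + s) * galChar p m (b * F x)) (fun μ => ?_) x
    simpa only [neg_neg, Finset.mul_sum, mul_assoc] using h (-μ)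
  · simp only [h, Finset.mul_sum, mul_assoc]

/-- The number of pairs `(a, t)` with `y = F (t + x - a) - F t + F a`. -/
noncomputable def derivCount {p n m : ℕ} [Fact p.Prime] (F : GaloisField p n → GaloisField p m)
    (x : GaloisField p n) (y : GaloisField p m) : ℕ :=
  ∑ a : GaloisField p n, ((Finset.univ : Finset (GaloisField p n)).filter fun t =>
    y = F (t + x - a) - F t + F a).card

lemma sum_derivCount_mul_galChar {p n m : ℕ} [Fact p.Prime]
    (F : GaloisField p n → GaloisField p m) (x : GaloisField p n) (b : GaloisField p m) :
    ∑ y, (derivCount F x y : ℂ) * galChar p m (b * y) =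
      tripleConv (fun x => galChar p m (b * F x)) x := by
  simp only [derivCount, Finset.card_filter, Nat.cast_sum, Nat.cast_ite, Nat.cast_one,
    Nat.cast_zero, Finset.sum_mul, tripleConv]
  rw [Finset.sum_comm]
  refine Finset.sum_congr rfl fun a _ => ?_
  rw [Finset.sum_comm]
  refine Finset.sum_congr rfl fun t _ => ?_
  simp only [ite_mul, one_mul, zero_mul, Finset.sum_ite_eq', Finset.mem_univ,
    if_true]
  rw [mul_add, mul_sub, sub_eq_add_neg, AddChar.map_add_eq_mul, AddChar.map_add_eq_mul,
    AddChar.map_neg_eq_conj]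

/-- The Fourier transform of a function taking one value off a point `z`. -/
lemma sum_ite_mul_galChar (p m : ℕ) [Fact p.Prime] (hm : 0 < m) (c r : ℂ)
    (z b : GaloisField p m) :
    ∑ y, (c + if y = z then r else 0) * galChar p m (b * y) =
      (if b = 0 then c * (p : ℂ) ^ m else 0) + r * galChar p m (b * z) := by
  simp only [add_mul, Finset.sum_add_distrib, ite_mul, zero_mul, Finset.sum_ite_eq',
    Finset.mem_univ, if_true, ← Finset.mul_sum]
  simp_rw [mul_comm b, AddChar.sum_mulShift _ (galChar_isPrimitive p m), card_galoisField p hm]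
  simp

/-- The value of the counting function at every point, in terms of the triple convolutions. -/
lemma derivCount_eq_iff {p n m : ℕ} [Fact p.Prime] (hn : 0 < n) (hm : 0 < m) (s : ℕ)
    (F : GaloisField p n → GaloisField p m) (x : GaloisField p n) :
    (∀ y, (derivCount F x y : ℂ) =
        ((p : ℂ) ^ (2 * n) - (p : ℂ) ^ (n + s)) / (p : ℂ) ^ m +
          if y = F x then (p : ℂ) ^ (n + s) else 0) ↔
      ∀ b, b ≠ 0 → tripleConv (fun x => galChar p m (b * F x)) x =
        (p : ℂ) ^ (n + s) * galChar p m (b * F x) := by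
  have hp : (p : ℂ) ≠ 0 := Nat.cast_ne_zero.mpr (Fact.out : p.Prime).ne_zero
  refine ⟨fun h b hb => ?_, fun h y => ?_⟩
  · rw [← sum_derivCount_mul_galChar]
    simp only [h]
    rw [sum_ite_mul_galChar p m hm, if_neg hb, zero_add]
  · refine eq_of_forall_sum_mul_addChar_eq (galChar_isPrimitive p m)
      (f := fun y => (derivCount F x y : ℂ))
      (g := fun y => ((p : ℂ) ^ (2 * n) - (p : ℂ) ^ (n + s)) / (p : ℂ) ^ m +
          if y = F x then (p : ℂ) ^ (n + s) else 0) (fun b => ?_) y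
    rw [sum_derivCount_mul_galChar, sum_ite_mul_galChar p m hm]
    by_cases hb : b = 0
    · subst hb
      simp only [tripleConv, zero_mul, AddChar.map_zero_eq_one, map_one, mul_one,
        Finset.sum_const, Finset.card_univ, card_galoisField p hn, if_true, nsmul_eq_mul]
      field_simp
      push_cast
      ring
    · rw [h b hb, if_neg hb, zero_add]

/-- `F` is vectorial `s`-plateaued iff for all `x, y`,
`∑_a #{s' : y = F(s'+x-a) - F(s') + F(a)}` equals `β = p^{n+s} + p^{2n-m} - p^{n+s-m}`
when `y = F(x)` and `α = p^{2n-m} - p^{n+s-m}` otherwise. -/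
theorem stmt2 (p n m : ℕ) [Fact p.Prime] (hn : 0 < n) (hm : 0 < m) (s : ℕ) (hs : s ≤ n)
    (F : GaloisField p n → GaloisField p m) :
    (∀ b : GaloisField p m, b ≠ 0 →
        IsPlateaued p n (fun x => trGF p m (b * F x)) s) ↔
      ∀ (x : GaloisField p n) (y : GaloisField p m),
        ((∑ a : GaloisField p n,
            ((Finset.univ : Finset (GaloisField p n)).filter fun s' =>
              y = F (s' + x - a) - F s' + F a).card : ℕ) : ℝ) =
          if y = F x then
            (p : ℝ) ^ ((n : ℤ) + (s : ℤ)) +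
              (p : ℝ) ^ (2 * (n : ℤ) - (m : ℤ)) - (p : ℝ) ^ ((n : ℤ) + (s : ℤ) - (m : ℤ))
          else
            (p : ℝ) ^ (2 * (n : ℤ) - (m : ℤ)) - (p : ℝ) ^ ((n : ℤ) + (s : ℤ) - (m : ℤ)) := by
  have hp : (p : ℝ) ≠ 0 := Nat.cast_ne_zero.mpr (Fact.out : p.Prime).ne_zero
  simp only [isPlateaued_trGF_iff]
  have swap : (∀ b : GaloisField p m, b ≠ 0 → ∀ x,
        tripleConv (fun x => galChar p m (b * F x)) x =
          (p : ℂ) ^ (n + s) * galChar p m (b * F x)) ↔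
      ∀ x, ∀ b : GaloisField p m, b ≠ 0 →
        tripleConv (fun x => galChar p m (b * F x)) x =
          (p : ℂ) ^ (n + s) * galChar p m (b * F x) :=
    ⟨fun h x b hb => h b hb x, fun h b hb x => h x b hb⟩
  rw [swap]
  refine forall_congr' fun x => (derivCount_eq_iff hn hm s F x).symm.trans
    (forall_congr' fun y => ?_)
  have hα : (p : ℝ) ^ (2 * (n : ℤ) - (m : ℤ)) - (p : ℝ) ^ ((n : ℤ) + (s : ℤ) - (m : ℤ)) =
      ((p : ℝ) ^ (2 * n) - (p : ℝ) ^ (n + s)) / (p : ℝ) ^ m := by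
    rw [zpow_sub₀ hp, zpow_sub₀ hp, sub_div]
    norm_cast
  have hβ : (p : ℝ) ^ ((n : ℤ) + (s : ℤ)) = (p : ℝ) ^ (n + s) := by norm_cast
  rw [add_sub_assoc, hα, hβ]
  change _ ↔ ((derivCount F x y : ℕ) : ℝ) = _
  rw [← Complex.ofReal_inj]
  split_ifs <;> push_cast
  · rw [add_comm]
  · rw [add_zero]
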